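/- Extreme-component expansion of a string of R-matrices acting on w ⊗ u_σ: let n, l ≥ 1, N = n + l ≥ 3, σ ∈ {+1,−1}, ζ₁, …, ζ_{N−1} ∈ ℂ∖{0} admissible, and let w ∈ V^{(n−1,l−1)} ⊆ V^{⊗(N−2)}. Then the coefficient of v₋^{⊗n} ⊗ v₊^{⊗l} (minus in slots 1,…,n, plus in slots n+1,…,N) in R_{N−1|1,…,N−2}(ζ_{N−1}|ζ₁,…,ζ_{N−2})(w ⊗ u_σ) ∈ V^{⊗N} equals Σ_{k=1}^{n} c(ζ_{N−1}/ζ_k) · (∏_{j=k+1}^{n} b(ζ_{N−1}/ζ_j)) · w^{(k)}, where w^{(k)} is the coefficient in w of the basis vector with index − at each position of {1,…,n}∖{k} and index + at position k and at positions n+1,…,N−2. -/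

import Mathlib

noncomputable section

open scoped BigOperators

/-- The infinite q-Pochhammer symbol `(a; p)_∞ = ∏_{k ≥ 0} (1 - a pᵏ)`. -/
def qPoch (a p : ℂ) : ℂ := ∏' k : ℕ, (1 - a * p ^ k)

/-- The double infinite q-Pochhammer symbol `(a; p, p)_∞ = ∏_{k,l ≥ 0} (1 - a p^{k+l})`. -/
def qPoch2 (a p : ℂ) : ℂ := ∏' kl : ℕ × ℕ, (1 - a * p ^ (kl.1 + kl.2))

/-- `θ(z|p) = (z;p)_∞ (p/z;p)_∞`. -/
def theta (z p : ℂ) : ℂ := qPoch z p * qPoch (p / z) p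

/-- `t(ζ) = ζ⁻¹ θ(qζ²|q⁴)/θ(qζ⁻²|q⁴)`. -/
def tfun (q ζ : ℂ) : ℂ := ζ⁻¹ * theta (q * ζ ^ 2) (q ^ 4) / theta (q * (ζ ^ 2)⁻¹) (q ^ 4)

/-- `b(ζ) = (1-ζ²)q/(1-ζ²q²)`. -/
def Rb (q ζ : ℂ) : ℂ := (1 - ζ ^ 2) * q / (1 - ζ ^ 2 * q ^ 2)

/-- `c(ζ) = (1-q²)ζ/(1-ζ²q²)`. -/
def Rc (q ζ : ℂ) : ℂ := (1 - q ^ 2) * ζ / (1 - ζ ^ 2 * q ^ 2)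

/-- The six-vertex R-matrix; the index `0 : Fin 2` encodes `+` and `1 : Fin 2` encodes `−`.
Rows are the upper (outgoing) indices, columns the lower (incoming) indices. -/
def Rmat (q ζ : ℂ) : Matrix (Fin 2 × Fin 2) (Fin 2 × Fin 2) ℂ :=
  Matrix.of fun e f =>
    if e.1 = e.2 then (if f = e then 1 else 0)
    else if f = e then Rb q ζ
    else if f = (e.2, e.1) then Rc q ζ
    else 0

/-- The transposition `P(x⊗y) = y⊗x` on `V ⊗ V`. -/
def Pmat : Matrix (Fin 2 × Fin 2) (Fin 2 × Fin 2) ℂ :=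
  Matrix.of fun e f => if f = (e.2, e.1) then 1 else 0

/-- The scalar factor `S₀(ζ)` with `z = ζ²`. -/
def S0 (q ζ : ℂ) : ℂ :=
  ζ * qPoch (ζ ^ 2)⁻¹ (q ^ 4) * qPoch (ζ ^ 2 * q ^ 2) (q ^ 4) /
    (qPoch (ζ ^ 2) (q ^ 4) * qPoch ((ζ ^ 2)⁻¹ * q ^ 2) (q ^ 4))

/-- The scattering matrix `S(ζ) = S₀(ζ) R(ζ)`. -/
def Smat (q ζ : ℂ) : Matrix (Fin 2 × Fin 2) (Fin 2 × Fin 2) ℂ := S0 q ζ • Rmat q ζ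

/-- Admissibility of the argument of the S-matrix: all denominators occurring in
`S(ζ)` are nonzero. -/
def Sdef (q ζ : ℂ) : Prop :=
  ζ ≠ 0 ∧ 1 - ζ ^ 2 * q ^ 2 ≠ 0 ∧ qPoch (ζ ^ 2) (q ^ 4) ≠ 0 ∧
    qPoch ((ζ ^ 2)⁻¹ * q ^ 2) (q ^ 4) ≠ 0

/-- Kronecker (tensor) product of two operators on `V`. -/
def kron (A B : Matrix (Fin 2) (Fin 2) ℂ) : Matrix (Fin 2 × Fin 2) (Fin 2 × Fin 2) ℂ :=
  Matrix.of fun e f => A e.1 f.1 * B e.2 f.2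

/-- `D = diag(δ, δ⁻¹)`. -/
def Dmat (δ : ℂ) : Matrix (Fin 2) (Fin 2) ℂ :=
  Matrix.of fun i j => if i = j then (if i = 0 then δ else δ⁻¹) else 0

/-- `D̄ = diag(δ, −δ⁻¹)`. -/
def Dbar (δ : ℂ) : Matrix (Fin 2) (Fin 2) ℂ :=
  Matrix.of fun i j => if i = j then (if i = 0 then δ else -δ⁻¹) else 0

/-- The operator on `V^{⊗N}` acting as `M` on the `(j,k)`-th tensor factors and as the
identity elsewhere.  A vector of `V^{⊗N}` is encoded by its coordinates
`(Fin N → Fin 2) → ℂ` in the basis `v_{ε₁} ⊗ ⋯ ⊗ v_{ε_N}`. -/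
def embed2 {N : ℕ} (M : Matrix (Fin 2 × Fin 2) (Fin 2 × Fin 2) ℂ) (j k : Fin N) :
    Matrix (Fin N → Fin 2) (Fin N → Fin 2) ℂ :=
  Matrix.of fun a b =>
    M (a j, a k) (b j, b k) *
      ∏ i : Fin N, (if i = j ∨ i = k then 1 else if a i = b i then 1 else 0)

/-- The operator on `V^{⊗N}` acting as `M` on the `j`-th tensor factor. -/
def embed1 {N : ℕ} (M : Matrix (Fin 2) (Fin 2) ℂ) (j : Fin N) :
    Matrix (Fin N → Fin 2) (Fin N → Fin 2) ℂ :=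
  Matrix.of fun a b =>
    M (a j) (b j) * ∏ i : Fin N, (if i = j then 1 else if a i = b i then 1 else 0)

/-- Number of `−` signs (i.e. of indices equal to `1`) in a basis configuration. -/
def countMinus {N : ℕ} (a : Fin N → Fin 2) : ℕ :=
  (Finset.univ.filter fun i => a i = 1).card

/-- Membership in the weight subspace `V^{(n l)} ⊆ V^{⊗N}` (with `l = N - n`):
the coordinates vanish off configurations with exactly `n` minus signs. -/
def inVnl {N : ℕ} (n : ℕ) (v : (Fin N → Fin 2) → ℂ) : Prop :=
  ∀ a, countMinus a ≠ n → v a = 0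

/-- The vector `w ⊗ u_σ ∈ V^{⊗N}`, where `w ∈ V^{⊗(N-2)}` occupies the slots `0,…,N-3`
and `u_σ = v₋⊗v₊ + σ v₊⊗v₋` occupies the slots `N-2, N-1`. -/
def tensU {N : ℕ} (hN : 2 ≤ N) (σ : ℂ) (w : (Fin (N - 2) → Fin 2) → ℂ) :
    (Fin N → Fin 2) → ℂ :=
  fun a =>
    w (fun i => a ⟨i.1, by have := i.isLt; omega⟩) *
      (if a ⟨N - 2, by omega⟩ = 1 ∧ a ⟨N - 1, by omega⟩ = 0 then 1
       else if a ⟨N - 2, by omega⟩ = 0 ∧ a ⟨N - 1, by omega⟩ = 1 then σ else 0)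

/-- `P₁₂ P₂₃ ⋯ P_{N−1,N}` on `V^{⊗N}` (1-based labels; 0-based sites `0,…,N-1`). -/
def Pchain (N : ℕ) : Matrix (Fin N → Fin 2) (Fin N → Fin 2) ℂ :=
  (List.ofFn fun t : Fin (N - 1) =>
    embed2 Pmat ⟨t.1, by have := t.isLt; omega⟩ ⟨t.1 + 1, by have := t.isLt; omega⟩).prod

/-- `S_{1,…,N−2|N−1}(ζ₁,…,ζ_{N−2}|w) = S_{1,N−1}(ζ₁/w) ⋯ S_{N−2,N−1}(ζ_{N−2}/w)`
(1-based labels; the `j`-th spectral parameter `ζ_j` is `ζ (j-1)`). -/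
def SchainUp (q : ℂ) (N : ℕ) (ζ : ℕ → ℂ) (w : ℂ) :
    Matrix (Fin N → Fin 2) (Fin N → Fin 2) ℂ :=
  (List.ofFn fun t : Fin (N - 2) =>
    embed2 (Smat q (ζ t.1 / w)) ⟨t.1, by have := t.isLt; omega⟩
      ⟨N - 2, by have := t.isLt; omega⟩).prod

/-- `S_{N−1|1,…,N−2}(w|ζ₁,…,ζ_{N−2}) = S_{N−1,N−2}(w/ζ_{N−2}) ⋯ S_{N−1,1}(w/ζ₁)`. -/
def SchainDown (q : ℂ) (N : ℕ) (ζ : ℕ → ℂ) (w : ℂ) :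
    Matrix (Fin N → Fin 2) (Fin N → Fin 2) ℂ :=
  (List.ofFn fun t : Fin (N - 2) =>
    embed2 (Smat q (w / ζ (N - 3 - t.1))) ⟨N - 2, by have := t.isLt; omega⟩
      ⟨N - 3 - t.1, by have := t.isLt; omega⟩).prod

/-- `R_{N−1|1,…,N−2}(w|ζ₁,…,ζ_{N−2}) = R_{N−1,N−2}(w/ζ_{N−2}) ⋯ R_{N−1,1}(w/ζ₁)`. -/
def RchainDown (q : ℂ) (N : ℕ) (ζ : ℕ → ℂ) (w : ℂ) :
    Matrix (Fin N → Fin 2) (Fin N → Fin 2) ℂ :=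
  (List.ofFn fun t : Fin (N - 2) =>
    embed2 (Rmat q (w / ζ (N - 3 - t.1))) ⟨N - 2, by have := t.isLt; omega⟩
      ⟨N - 3 - t.1, by have := t.isLt; omega⟩).prod

/-- `R_{1,…,M−1|M}(ζ₁,…,ζ_{M−1}|w) = R_{1,M}(ζ₁/w) ⋯ R_{M−1,M}(ζ_{M−1}/w)` on `V^{⊗M}`. -/
def RchainUp (q : ℂ) (M : ℕ) (ζ : ℕ → ℂ) (w : ℂ) :
    Matrix (Fin M → Fin 2) (Fin M → Fin 2) ℂ :=
  (List.ofFn fun t : Fin (M - 1) =>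
    embed2 (Rmat q (ζ t.1 / w)) ⟨t.1, by have := t.isLt; omega⟩
      ⟨M - 1, by have := t.isLt; omega⟩).prod

/-- The action of `Δ^{(M-1)}(f₀)` on the tensor product of evaluation representations
with parameters `ζ 0, …, ζ (M-1)`:
`π(f₀) = Σ_j 1^{⊗j} ⊗ π_{ζ_j}(f₀) ⊗ π(t₀⁻¹) ⊗ ⋯ ⊗ π(t₀⁻¹)`, where
`π_ζ(f₀)v₊ = 0`, `π_ζ(f₀)v₋ = ζ⁻¹v₊`, `π_ζ(t₀⁻¹)v₊ = q v₊`, `π_ζ(t₀⁻¹)v₋ = q⁻¹ v₋`. -/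
def f0op (q : ℂ) (M : ℕ) (ζ : ℕ → ℂ) : Matrix (Fin M → Fin 2) (Fin M → Fin 2) ℂ :=
  ∑ j : Fin M, Matrix.of fun a b =>
    (if a j = 0 ∧ b j = 1 then (ζ j.1)⁻¹ else 0) *
      ∏ i : Fin M,
        (if i < j then (if a i = b i then 1 else 0)
         else if j < i then (if a i = b i then (if b i = 0 then q else q⁻¹) else 0)
         else 1)

/-- `M = tr_{N−1}( D̄_{N−1} R_{1,…,N−2|N−1}(ζ₁,…,ζ_{N−2}|ζ_{N−1}) ) ∈ End(V^{⊗(N−2)})`: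
partial trace over the last factor of `V^{⊗(N-1)}`. -/
def Mop (q δ : ℂ) (N : ℕ) (hN : 3 ≤ N) (ζ : ℕ → ℂ) :
    Matrix (Fin (N - 2) → Fin 2) (Fin (N - 2) → Fin 2) ℂ :=
  Matrix.of fun a b => ∑ e : Fin 2,
    (embed1 (N := N - 1) (Dbar δ) ⟨N - 2, by omega⟩ * RchainUp q (N - 1) ζ (ζ (N - 2)))
      (fun i => if h : i.1 < N - 2 then a ⟨i.1, h⟩ else e)
      (fun i => if h : i.1 < N - 2 then b ⟨i.1, h⟩ else e)


lemma prod_delta {N : ℕ} (j k : Fin N) (a b : Fin N → Fin 2) :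
    (∏ i : Fin N, (if i = j ∨ i = k then (1:ℂ) else if a i = b i then 1 else 0))
      = if (∀ i, i ≠ j → i ≠ k → a i = b i) then 1 else 0 := by
  split_ifs with h
  · apply Finset.prod_eq_one
    intro i _
    by_cases h1 : i = j ∨ i = k
    · simp [h1]
    · push Not at h1
      simp [h1, h i h1.1 h1.2]
  · push Not at h
    obtain ⟨i, h1, h2, h3⟩ := h
    apply Finset.prod_eq_zero (Finset.mem_univ i)
    simp [h1, h2, h3]

lemma embed_same {N : ℕ} (q z : ℂ) (j k : Fin N) (v : (Fin N → Fin 2) → ℂ)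
    (a : Fin N → Fin 2) (h : a j = a k) :
    (embed2 (Rmat q z) j k).mulVec v a = v a := by
  unfold Matrix.mulVec dotProduct
  rw [Finset.sum_eq_single a]
  · simp [embed2, Rmat, h]
  · intro b _ hb
    simp only [embed2, Matrix.of_apply, prod_delta, Rmat, h, if_true]
    by_cases h2 : ∀ i, i ≠ j → i ≠ k → a i = b i
    · have : ¬ ((b j, b k) = (a k, a k)) := by
        intro h3
        rw [Prod.mk.injEq] at h3
        apply hb
        funext i
        by_cases hj : i = j
        · rw [hj, h3.1, h]
        by_cases hk : i = k
        · rw [hk, h3.2]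
        exact (h2 i hj hk).symm
      rw [if_neg this]; simp
    · rw [if_neg h2]; simp
  · simp

lemma embed_diff {N : ℕ} (q z : ℂ) (j k : Fin N) (v : (Fin N → Fin 2) → ℂ)
    (a a' : Fin N → Fin 2) (h : a j ≠ a k) (h1 : a' j = a k) (h2 : a' k = a j)
    (h3 : ∀ i, i ≠ j → i ≠ k → a i = a' i) :
    (embed2 (Rmat q z) j k).mulVec v a = Rb q z * v a + Rc q z * v a' := by
  unfold Matrix.mulVec dotProduct
  have hne : a ≠ a' := by
    intro e; apply h; rw [← h1, ← e]
  rw [Finset.sum_eq_add a a' hne]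
  · simp only [embed2, Matrix.of_apply, prod_delta, Rmat, h1, h2]
    rw [if_pos h3]
    simp [h, Ne.symm h]
  · intro b _ hb
    simp only [embed2, Matrix.of_apply, prod_delta, Rmat, h, if_false]
    by_cases h4 : ∀ i, i ≠ j → i ≠ k → a i = b i
    · have e1 : ¬ ((b j, b k) = (a j, a k)) := by
        intro e
        rw [Prod.mk.injEq] at e
        apply hb.1
        funext i
        by_cases hj : i = j
        · rw [hj, e.1]
        by_cases hk : i = k
        · rw [hk, e.2]
        exact (h4 i hj hk).symm
      have e2 : ¬ ((b j, b k) = (a k, a j)) := by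
        intro e
        rw [Prod.mk.injEq] at e
        apply hb.2
        funext i
        by_cases hj : i = j
        · rw [hj, e.1, h1]
        by_cases hk : i = k
        · rw [hk, e.2, h2]
        rw [← h4 i hj hk, h3 i hj hk]
      rw [if_neg e1, if_neg e2]; simp
    · rw [if_neg h4]; simp
  · simp
  · simp

/-- Iterated action on a vector. -/
def Tit (q : ℂ) (N : ℕ) (ζ : ℕ → ℂ) (x : ℂ) (v : (Fin N → Fin 2) → ℂ) :
    ℕ → (Fin N → Fin 2) → ℂ
  | 0 => v
  | m + 1 => if h : m < N - 2 then
      (embed2 (Rmat q (x / ζ m)) (⟨N - 2, by omega⟩ : Fin N) ⟨m, by omega⟩).mulVec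
        (Tit q N ζ x v m) else Tit q N ζ x v m

lemma Tit_list (q : ℂ) (N : ℕ) (ζ : ℕ → ℂ) (x : ℂ) (v : (Fin N → Fin 2) → ℂ)
    (m : ℕ) (hm : m ≤ N - 2) :
    ((List.ofFn fun t : Fin m =>
      embed2 (Rmat q (x / ζ (m - 1 - t.1))) (⟨N - 2, by have := t.isLt; omega⟩ : Fin N)
      ⟨m - 1 - t.1, by have := t.isLt; omega⟩).prod).mulVec v = Tit q N ζ x v m := by
  induction m with
  | zero => simp [Tit]
  | succ m ih =>
    have hm' : m < N - 2 := by omega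
    rw [List.ofFn_succ, List.prod_cons, ← Matrix.mulVec_mulVec, Tit, dif_pos hm', ← ih (by omega)]
    have e : ∀ t : Fin m, m + 1 - 1 - (t.succ).1 = m - 1 - t.1 := by
      intro t; simp only [Fin.val_succ]; omega
    simp only [e]
    rfl

lemma Tit_one (q : ℂ) (N : ℕ) (hN : 3 ≤ N) (ζ : ℕ → ℂ) (x : ℂ) (v : (Fin N → Fin 2) → ℂ)
    (a : Fin N → Fin 2) (hA : a ⟨N - 2, by omega⟩ = 1)
    (m : ℕ) (hm : m ≤ N - 2) (ha : ∀ i : Fin N, i.1 < m → a i = 1) :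
    Tit q N ζ x v m a = v a := by
  induction m with
  | zero => rfl
  | succ m ih =>
    rw [Tit, dif_pos (by omega), embed_same]
    · exact ih (by omega) (fun i hi => ha i (by omega))
    · rw [hA, ha _ (by simp)]

lemma Tit_two (q : ℂ) (N : ℕ) (hN : 3 ≤ N) (ζ : ℕ → ℂ) (x : ℂ) (v : (Fin N → Fin 2) → ℂ)
    (a : Fin N → Fin 2) (hA : a ⟨N - 2, by omega⟩ = 0) (hv : v a = 0)
    (m : ℕ) (hm : m ≤ N - 2) (ha : ∀ i : Fin N, i.1 < m → a i = 1) :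
    Tit q N ζ x v m a = ∑ k ∈ Finset.range m, Rc q (x / ζ k) *
          (∏ j ∈ Finset.Ico (k + 1) m, Rb q (x / ζ j)) *
          v (fun i => if i.1 = k then 0 else if i.1 = N - 2 then 1 else a i) := by
  induction m with
  | zero => simpa [Tit] using hv
  | succ m ih =>
    have ham : a ⟨m, by omega⟩ = 1 := ha _ (by simp)
    rw [Tit, dif_pos (by omega), embed_diff q _ _ _ _ a
      (fun i => if i.1 = m then 0 else if i.1 = N - 2 then 1 else a i),
      ih (by omega) (fun i hi => ha i (by omega)), Finset.sum_range_succ, Tit_one q N hN]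
    · congr 1
      · rw [Finset.mul_sum]
        apply Finset.sum_congr rfl
        intro k hk
        rw [Finset.prod_Ico_succ_top (by have := Finset.mem_range.1 hk; omega)]
        ring
      · simp
    · simp; omega
    · omega
    · intro i hi
      rw [if_neg (by omega), if_neg (by omega)]
      exact ha i (by omega)
    · rw [hA, ham]; simp
    · rw [ham]
      simp; omega
    · rw [hA]; simp
    · intro i h1 h2
      have h1' : i.1 ≠ N - 2 := fun e => h1 (Fin.ext e)
      have h2' : i.1 ≠ m := fun e => h2 (Fin.ext e)
      simp [h1', h2']

lemma Tit_three (q : ℂ) (N : ℕ) (hN : 3 ≤ N) (ζ : ℕ → ℂ) (x : ℂ) (v : (Fin N → Fin 2) → ℂ)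
    (a : Fin N → Fin 2) (hA : a ⟨N - 2, by omega⟩ = 0) (n : ℕ)
    (ha : ∀ i : Fin N, n ≤ i.1 → a i = 0)
    (m : ℕ) (hnm : n ≤ m) (hm : m ≤ N - 2) :
    Tit q N ζ x v m a = Tit q N ζ x v n a := by
  induction m, hnm using Nat.le_induction with
  | base => rfl
  | succ m h ih =>
    rw [Tit, dif_pos (by omega), embed_same]
    · exact ih (by omega)
    · rw [hA, ha _ h]

/-- Extreme-component expansion of
`R_{N−1|1,…,N−2}(ζ_{N−1}|ζ₁,…,ζ_{N−2})(w ⊗ u_σ)` for `w ∈ V^{(n−1,l−1)}`: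
the coefficient of `v₋^{⊗n} ⊗ v₊^{⊗l}` equals
`Σ_{k=1}^n c(ζ_{N−1}/ζ_k) (∏_{j=k+1}^n b(ζ_{N−1}/ζ_j)) w^{(k)}`.
Here the sequence `ζ : ℕ → ℂ` encodes `ζ_j = ζ (j-1)` (so `ζ_{N-1} = ζ (N-2)`),
and indices `k` are 0-based. -/
theorem Rchain_extreme_component (q : ℂ) (hq : q ≠ 0) (hq2 : q ^ 2 ≠ 1)
    (n l : ℕ) (hn : 1 ≤ n) (hl : 1 ≤ l) (N : ℕ) (hNdef : N = n + l) (hN : 3 ≤ N)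
    (σ : ℂ) (hσ : σ = 1 ∨ σ = -1)
    (ζ : ℕ → ℂ) (hζ : ∀ i < N - 1, ζ i ≠ 0)
    (hadm : ∀ j < N - 2, 1 - (ζ (N - 2) / ζ j) ^ 2 * q ^ 2 ≠ 0)
    (w : (Fin (N - 2) → Fin 2) → ℂ) (hw : inVnl (n - 1) w) :
    (RchainDown q N ζ (ζ (N - 2))).mulVec (tensU (by omega) σ w)
        (fun i => if i.1 < n then 1 else 0)
      = ∑ k ∈ Finset.range n, Rc q (ζ (N - 2) / ζ k) *
          (∏ j ∈ Finset.Ico (k + 1) n, Rb q (ζ (N - 2) / ζ j)) *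
          w (fun i => if i.1 = k then 0 else if i.1 < n then 1 else 0) := by
  have key : (RchainDown q N ζ (ζ (N - 2))).mulVec (tensU (by omega) σ w)
      = Tit q N ζ (ζ (N - 2)) (tensU (by omega) σ w) (N - 2) :=
    Tit_list q N ζ (ζ (N - 2)) _ (N - 2) le_rfl
  rw [key]
  by_cases hl1 : l = 1
  · obtain ⟨m, rfl⟩ : ∃ m, n = m + 1 := ⟨n - 1, by omega⟩
    have hm : N - 2 = m := by omega
    have hz : ζ (N - 2) ≠ 0 := hζ _ (by omega)
    have hq3 : 1 - q ^ 2 ≠ 0 := fun h => hq2 (by linear_combination -h)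
    rw [Tit_one q N hN _ _ _ _ (by simp; omega) _ le_rfl (by intro i hi; simp; omega),
      Finset.sum_range_succ, Finset.sum_eq_zero]
    · rw [← hm, div_self hz]
      simp only [tensU, Rc]
      rw [if_pos (by constructor <;> simp <;> omega)]
      have : (fun i : Fin (N - 2) => if i.1 < N - 2 + 1 then (1 : Fin 2) else 0)
        = fun i => if i.1 = N - 2 then 0 else if i.1 < N - 2 + 1 then 1 else 0 := by
        funext i
        rw [if_neg (c := i.1 = N - 2) (by have := i.isLt; omega)]
      rw [this]
      simp [div_self hq3]
    · intro k hk
      have hk := Finset.mem_range.1 hk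
      rw [Finset.prod_eq_zero (i := m)]
      · simp
      · simp; omega
      · rw [hm, div_self (by rwa [hm] at hz)]; simp [Rb]
  · have hA : (fun i : Fin N => if i.1 < n then (1 : Fin 2) else 0) ⟨N - 2, by omega⟩ = 0 := by
      simp; omega
    rw [Tit_three q N hN _ _ _ _ hA n (by intro i hi; simp; omega) _ (by omega) le_rfl,
      Tit_two q N hN _ _ _ _ hA _ n (by omega) (by intro i hi; simp; omega)]
    · apply Finset.sum_congr rfl
      intro k hk
      have hk := Finset.mem_range.1 hk
      congr 1
      simp only [tensU]
      rw [if_pos (by constructor <;> split_ifs <;> first | rfl | omega), mul_one]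
      congr 1
      funext i
      have := i.isLt
      rw [if_neg (c := i.1 = N - 2) (by omega)]
    · simp only [tensU]
      rw [if_neg, if_neg, mul_zero]
      · simp; omega
      · simp; omega
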